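/- arXiv:1712.01227 — 2 statements merged into one kernel-verified Lean document; each statement's English description precedes it below -/
import Mathlib

section
/- Let (X,d) be a complete separable metric space, T ⊆ X, and D ⊆ X a countable dense subset. Let 0 < α < α' < 1 and 0 < β' < β < 1 with αβ = α'β'. If player I has a winning strategy in the rational Schmidt (α,β) game (with respect to D) with target set T, then player I has a winning strategy in Schmidt's (α',β') game with target set T. -/
open Filter Topology

/-- The history (the list of moves) of the first `n` moves of the run `f`. -/
def histOf {M : Type*} (f : ℕ → M) (n : ℕ) : List M := (List.range n).map f

/-- The axiom of determinacy `AD` for integer games: for every payoff set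
`A ⊆ ℕ^ℕ`, in the game where I plays `x (2k)` and II plays `x (2k+1)`, and I wins
iff `x ∈ A`, one of the players has a winning strategy. -/
def AD : Prop :=
  ∀ A : Set (ℕ → ℕ),
    (∃ σ : List ℕ → ℕ, ∀ x : ℕ → ℕ, (∀ k, x (2 * k) = σ (histOf x (2 * k))) → x ∈ A) ∨
    (∃ τ : List ℕ → ℕ, ∀ x : ℕ → ℕ, (∀ k, x (2 * k + 1) = τ (histOf x (2 * k + 1))) → x ∉ A)

/-- A specification of an infinite two-player game with moves in `M`:
`firstOK` constrains the first move, `moveOK` constrains every single move,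
`stepOK i` constrains consecutive moves (at indices `i`, `i+1`), and `payoffII`
is the winning condition for player II on rule-following runs. -/
structure GameSpec (M : Type*) where
  firstOK : M → Prop
  moveOK : M → Prop
  stepOK : ℕ → M → M → Prop
  payoffII : (ℕ → M) → Prop

namespace GameSpec

variable {M : Type*} (G : GameSpec M)

/-- The first `n` moves of the run `f` follow the rules. -/
def LegalUpTo (f : ℕ → M) (n : ℕ) : Prop :=
  (0 < n → G.firstOK (f 0)) ∧ (∀ i < n, G.moveOK (f i)) ∧
    ∀ i, i + 1 < n → G.stepOK i (f i) (f (i + 1))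

/-- The whole run `f` follows the rules. -/
def Legal (f : ℕ → M) : Prop :=
  G.firstOK (f 0) ∧ (∀ i, G.moveOK (f i)) ∧ ∀ i, G.stepOK i (f i) (f (i + 1))

/-- A finite position (a finite sequence of moves) follows the rules. -/
def ListLegal (p : List M) : Prop :=
  ∃ f : ℕ → M, histOf f p.length = p ∧ G.LegalUpTo f p.length

/-- Player I (who makes the even-indexed moves) follows strategy `σ` in the run `f`. -/
def FollowsI (σ : List M → M) (f : ℕ → M) : Prop :=
  ∀ k, f (2 * k) = σ (histOf f (2 * k))

/-- Player II (who makes the odd-indexed moves) follows strategy `τ` in the run `f`. -/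
def FollowsII (τ : List M → M) (f : ℕ → M) : Prop :=
  ∀ k, f (2 * k + 1) = τ (histOf f (2 * k + 1))

/-- `σ` is a winning strategy for player I: whenever player I follows `σ`, player I
never violates the rules first, and if the whole run follows the rules then the run
is won by player I (i.e. it does not satisfy player II's payoff condition). -/
def WinningI (σ : List M → M) : Prop :=
  ∀ f : ℕ → M, FollowsI σ f →
    (∀ n, G.LegalUpTo f (2 * n) → G.LegalUpTo f (2 * n + 1)) ∧
      (G.Legal f → ¬ G.payoffII f)

/-- `τ` is a winning strategy for player II: whenever player II follows `τ`, player II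
never violates the rules first, and if the whole run follows the rules then the run
satisfies player II's payoff condition. -/
def WinningII (τ : List M → M) : Prop :=
  ∀ f : ℕ → M, FollowsII τ f →
    (∀ n, G.LegalUpTo f (2 * n + 1) → G.LegalUpTo f (2 * n + 2)) ∧
      (G.Legal f → G.payoffII f)

/-- The game is determined: one of the two players has a winning strategy. -/
def Determined : Prop := (∃ σ, G.WinningI σ) ∨ (∃ τ, G.WinningII τ)

end GameSpec

/-- Schmidt's `(α, β)` game on the metric space `X` with target set `T`.
Moves are pairs `(center, radius)`; the first radius must be positive, each ball
must be contained in the previous one (`ρ_{i+1} + d(x_i, x_{i+1}) ≤ ρ_i`), radii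
shrink by `α` after an even-indexed (player I) move and by `β` after an
odd-indexed (player II) move.  Player II wins a rule-following run iff the unique
point of intersection of the balls (the limit of the centers) lies in `T`. -/
def schmidtGame {X : Type*} [MetricSpace X] (α β : ℝ) (T : Set X) :
    GameSpec (X × ℝ) where
  firstOK m := 0 < m.2
  moveOK _ := True
  stepOK i prev next :=
    next.2 + dist prev.1 next.1 ≤ prev.2 ∧ next.2 = (if Even i then α else β) * prev.2
  payoffII f := ∃ z ∈ T, Tendsto (fun n => (f n).1) atTop (𝓝 z)

/-- Schmidt's `(α, β, ρ)` game: like the `(α, β)` game but the first radius must be `ρ`. -/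
def schmidtGameFixed {X : Type*} [MetricSpace X] (α β ρ : ℝ) (T : Set X) :
    GameSpec (X × ℝ) :=
  { schmidtGame α β T with firstOK := fun m => m.2 = ρ }

/-- The set of radii allowed in the rational Schmidt game: positive rational
multiples of `α^n * β^m`. -/
def ratRadii (α β : ℝ) : Set ℝ :=
  {r | ∃ (n m : ℕ) (q : ℚ), 0 < q ∧ r = α ^ n * β ^ m * (q : ℝ)}

/-- The rational Schmidt `(α, β)` game with respect to a countable dense set `D`:
Schmidt's `(α, β)` game where moreover every move `(x, ρ)` must have `x ∈ D` and
`ρ ∈ ⋃_{n,m} α^n β^m ℚ_{>0}`. -/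
def rationalSchmidtGame {X : Type*} [MetricSpace X] (α β : ℝ) (D : Set X) (T : Set X) :
    GameSpec (X × ℝ) :=
  { schmidtGame α β T with moveOK := fun m => m.1 ∈ D ∧ m.2 ∈ ratRadii α β }

theorem histOf_mapIdx {M N : Type*} (φ : ℕ → M → N) (f : ℕ → M) (n : ℕ) :
    (histOf f n).mapIdx φ = histOf (fun i => φ i (f i)) n := by
  apply List.ext_getElem <;> simp [histOf]

namespace GameSpec

variable {M : Type*} {G : GameSpec M} {f : ℕ → M}

theorem legalUpTo_zero : G.LegalUpTo f 0 :=
  ⟨fun h => absurd h (lt_irrefl 0), fun _ h => absurd h (Nat.not_lt_zero _),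
    fun _ h => absurd h (Nat.not_lt_zero _)⟩

theorem LegalUpTo.mono {m n : ℕ} (h : G.LegalUpTo f n) (hmn : m ≤ n) : G.LegalUpTo f m :=
  ⟨fun hm => h.1 (hm.trans_le hmn), fun i hi => h.2.1 i (hi.trans_le hmn),
    fun i hi => h.2.2 i (hi.trans_le hmn)⟩

theorem LegalUpTo.extend {n : ℕ} (h : G.LegalUpTo f (n + 1)) (hm : G.moveOK (f (n + 1)))
    (hs : G.stepOK n (f n) (f (n + 1))) : G.LegalUpTo f (n + 2) := by
  refine ⟨fun _ => h.1 n.succ_pos, fun i hi => ?_, fun i hi => ?_⟩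
  · rcases Nat.lt_succ_iff_lt_or_eq.mp hi with hi | rfl
    exacts [h.2.1 i hi, hm]
  · rcases Nat.lt_succ_iff_lt_or_eq.mp (show i < n + 1 by lia) with hi | rfl
    exacts [h.2.2 i (by lia), hs]

theorem Legal.legalUpTo (h : G.Legal f) (n : ℕ) : G.LegalUpTo f n :=
  ⟨fun _ => h.1, fun i _ => h.2.1 i, fun i _ => h.2.2 i⟩

theorem legal_of_forall_legalUpTo (h : ∀ n, G.LegalUpTo f n) : G.Legal f :=
  ⟨(h 1).1 one_pos, fun i => (h (i + 1)).2.1 i i.lt_succ_self,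
    fun i => (h (i + 2)).2.2 i (Nat.lt_succ_self _)⟩

end GameSpec

theorem pos_of_mem_ratRadii {α β r : ℝ} (hα : 0 < α) (hβ : 0 < β) (hr : r ∈ ratRadii α β) :
    0 < r := by
  obtain ⟨n, m, q, hq, rfl⟩ := hr
  have : (0 : ℝ) < q := by exact_mod_cast hq
  positivity

theorem mul_mem_ratRadii {α β r : ℝ} (hr : r ∈ ratRadii α β) : α * r ∈ ratRadii α β := by
  obtain ⟨n, m, q, hq, rfl⟩ := hr
  exact ⟨n + 1, m, q, hq, by ring⟩

theorem schmidtGame_radius_tendsto_zero {X : Type*} [MetricSpace X] {α β : ℝ} {T : Set X}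
    (hα : 0 < α) (hα' : α < 1) (hβ : 0 < β) (hβ' : β < 1) {f : ℕ → X × ℝ}
    (hf : (schmidtGame α β T).Legal f) : Tendsto (fun i => (f i).2) atTop (𝓝 0) := by
  have hstep : ∀ i, (f (i + 1)).2 = (if Even i then α else β) * (f i).2 := fun i => (hf.2.2 i).2
  have hpos : ∀ i, 0 < (f i).2 := by
    intro i
    induction i with
    | zero => exact hf.1
    | succ i ih =>
      rw [hstep]
      split_ifs <;> positivity
  have hγ : 0 < max α β := lt_max_of_lt_left hα
  have hle : ∀ i, (f i).2 ≤ max α β ^ i * (f 0).2 := by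
    intro i
    induction i with
    | zero => simp
    | succ i ih =>
      calc (f (i + 1)).2 ≤ max α β * (f i).2 := by
            rw [hstep]
            refine mul_le_mul_of_nonneg_right ?_ (hpos i).le
            split_ifs
            exacts [le_max_left _ _, le_max_right _ _]
        _ ≤ max α β * (max α β ^ i * (f 0).2) := mul_le_mul_of_nonneg_left ih hγ.le
        _ = max α β ^ (i + 1) * (f 0).2 := by ring
  refine squeeze_zero (fun i => (hpos i).le) hle ?_
  simpa using (tendsto_pow_atTop_nhds_zero_of_lt_one hγ.le (max_lt hα' hβ')).mul_const (f 0).2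

/-- If `0 < α < α' < 1`, `0 < β' < β < 1`, `αβ = α'β'`, and player I has a winning
strategy in the rational Schmidt `(α, β)` game (w.r.t. a countable dense `D`) with
target set `T`, then player I has a winning strategy in Schmidt's `(α', β')` game
with target set `T`. -/
theorem winningI_of_rational_winningI {X : Type*} [MetricSpace X] [CompleteSpace X]
    [TopologicalSpace.SeparableSpace X]
    (T D : Set X) (hDc : D.Countable) (hDd : Dense D)
    (α α' β β' : ℝ) (h1 : 0 < α) (h2 : α < α') (h3 : α' < 1)
    (h4 : 0 < β') (h5 : β' < β) (h6 : β < 1) (hp : α * β = α' * β')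
    (h : ∃ σ, (rationalSchmidtGame α β D T).WinningI σ) :
    ∃ σ, (schmidtGame α' β' T).WinningI σ := by
  obtain ⟨σ, hσ⟩ := h
  have hα' : 0 < α' := h1.trans h2
  have hβ : 0 < β := h4.trans h5
  have happrox : ∀ (x : X) (ε : ℝ), ∃ y ∈ D, 0 < ε → dist x y < ε := by
    intro x ε
    obtain ⟨y, hy, hxy⟩ := hDd.exists_dist_lt x (ε := if 0 < ε then ε else 1)
      (by split_ifs with hε <;> [exact hε; exact one_pos])
    exact ⟨y, hy, fun hε => by simpa [hε] using hxy⟩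
  choose c hcD hcdist using happrox
  -- Even moves are kept; an odd move is replaced by a nearby rational move with smaller radius.
  let φ : ℕ → X × ℝ → X × ℝ := fun i m =>
    if Even i then m else (c m.1 ((α' - α) / α' * m.2), α / α' * m.2)
  refine ⟨fun p => σ (p.mapIdx φ), fun f hf => ?_⟩
  let g : ℕ → X × ℝ := fun i => φ i (f i)
  have hg_even : ∀ k, g (2 * k) = f (2 * k) := fun k => if_pos (even_two_mul k)
  have hg_odd : ∀ k, g (2 * k + 1) =
      (c (f (2 * k + 1)).1 ((α' - α) / α' * (f (2 * k + 1)).2), α / α' * (f (2 * k + 1)).2) :=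
    fun k => if_neg (Nat.not_even_two_mul_add_one k)
  have hg : GameSpec.FollowsI σ g := fun k => by
    rw [hg_even, hf k]
    exact congrArg σ (histOf_mapIdx φ f _)
  obtain ⟨hg_legal, hg_win⟩ := hσ g hg
  -- The data of a legal pair of moves `2k`, `2k+1`.
  have hstep : ∀ k, (rationalSchmidtGame α β D T).LegalUpTo g (2 * k + 1) →
      (schmidtGame α' β' T).stepOK (2 * k) (f (2 * k)) (f (2 * k + 1)) →
      (f (2 * k + 1)).2 = α' * (f (2 * k)).2 ∧ 0 < (f (2 * k)).2 ∧
      (g (2 * k + 1)).2 = α * (f (2 * k)).2 ∧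
      dist (f (2 * k + 1)).1 (g (2 * k + 1)).1 < (α' - α) * (f (2 * k)).2 ∧
      (rationalSchmidtGame α β D T).LegalUpTo g (2 * k + 2) := by
    intro k hk hs
    obtain ⟨hs1, hs2⟩ := hs
    rw [if_pos (even_two_mul k)] at hs2
    have hmem := (hk.2.1 (2 * k) (Nat.lt_succ_self _)).2
    rw [hg_even] at hmem
    have hr : 0 < (f (2 * k)).2 := pos_of_mem_ratRadii h1 hβ hmem
    have hrad : (g (2 * k + 1)).2 = α * (f (2 * k)).2 := by
      rw [hg_odd, hs2]
      field_simp
    have hε : (α' - α) / α' * (f (2 * k + 1)).2 = (α' - α) * (f (2 * k)).2 := by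
      rw [hs2]
      field_simp
    have hd : dist (f (2 * k + 1)).1 (g (2 * k + 1)).1 < (α' - α) * (f (2 * k)).2 := by
      rw [hg_odd, hε]
      exact hcdist _ _ (mul_pos (sub_pos.mpr h2) hr)
    refine ⟨hs2, hr, hrad, hd, hk.extend ⟨?_, ?_⟩ ⟨?_, ?_⟩⟩
    · rw [hg_odd]
      exact hcD _ _
    · rw [hrad]
      exact mul_mem_ratRadii hmem
    · rw [hrad, hg_even]
      have := dist_triangle (f (2 * k)).1 (f (2 * k + 1)).1 (g (2 * k + 1)).1
      linarith
    · rw [hrad, hg_even, if_pos (even_two_mul k)]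
  have hlegal : ∀ n, (schmidtGame α' β' T).LegalUpTo f (2 * n) →
      (rationalSchmidtGame α β D T).LegalUpTo g (2 * n + 1) := by
    intro n
    induction n with
    | zero => exact fun _ => hg_legal 0 GameSpec.legalUpTo_zero
    | succ k ih =>
      intro hfl
      have hk := ih (hfl.mono (by lia))
      exact hg_legal (k + 1) (hstep k hk (hfl.2.2 (2 * k) (by lia))).2.2.2.2
  refine ⟨fun n hfl => ?_, fun hfl => ?_⟩
  · have hgl := hlegal n hfl
    cases n with
    | zero =>
      have hfirst : 0 < (g (2 * 0)).2 := hgl.1 one_pos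
      rw [hg_even] at hfirst
      exact ⟨fun _ => hfirst, fun _ _ => trivial, fun i hi => absurd hi (by lia)⟩
    | succ k =>
      obtain ⟨hs2, hr, hrad, hd, -⟩ :=
        hstep k (hgl.mono (by lia)) (hfl.2.2 (2 * k) (by lia))
      obtain ⟨ht1, ht2⟩ := hgl.2.2 (2 * k + 1) (by lia)
      have hev : g (2 * k + 1 + 1) = f (2 * k + 1 + 1) := hg_even (k + 1)
      rw [if_neg (Nat.not_even_two_mul_add_one k), hev, hrad] at ht2
      rw [hev, hrad] at ht1
      have hrad' : (f (2 * k + 1 + 1)).2 = β' * (f (2 * k + 1)).2 := by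
        rw [ht2, hs2]
        linear_combination (f (2 * k)).2 * hp
      refine GameSpec.LegalUpTo.extend (n := 2 * k + 1) hfl trivial ⟨?_, ?_⟩
      · have := dist_triangle (f (2 * k + 1)).1 (g (2 * k + 1)).1 (f (2 * k + 1 + 1)).1
        linarith
      · rw [if_neg (Nat.not_even_two_mul_add_one k)]
        exact hrad'
  · rintro ⟨z, hzT, hz⟩
    have hgl : ∀ k, (rationalSchmidtGame α β D T).LegalUpTo g (2 * k + 1) :=
      fun k => hlegal k (hfl.legalUpTo _)
    refine hg_win (GameSpec.legal_of_forall_legalUpTo fun n => (hgl n).mono (by lia))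
      ⟨z, hzT, ?_⟩
    have hr0 := schmidtGame_radius_tendsto_zero hα' h3 h4 (h5.trans h6) hfl
    refine (tendsto_iff_of_dist (squeeze_zero (fun _ => dist_nonneg) (fun i => ?_)
      (by simpa using hr0.const_mul ((α' - α) / α')))).mp hz
    obtain ⟨k, rfl | rfl⟩ := Nat.even_or_odd' i
    · rw [hg_even, dist_self]
      have hr := (hstep k (hgl k) (hfl.2.2 _)).2.1
      have := sub_pos.mpr h2
      positivity
    · obtain ⟨hs2, -, -, hd, -⟩ := hstep k (hgl k) (hfl.2.2 _)
      refine hd.le.trans_eq ?_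
      rw [hs2]
      field_simp
end

section
/- Let α, β ∈ (0,1) with α(2−β) < 1, let ρ > 0, and set r = ρ(1 − 2α(1−β)/(1−αβ)) > 0. Let R ⊆ ℝ × [0,2π) satisfy ∀x ∈ ℝ ∃θ ∈ [0,2π) (x,θ) ∈ R, and let T = {(x, r·cos θ, r·sin θ) : (x,θ) ∈ R} ∪ {(x,y,z) ∈ ℝ³ : √(y²+z²) > r}. If τ is a winning strategy for player II in Schmidt's (α,β,ρ) game on ℝ³ (Euclidean metric) with target set T, then for every x ∈ ℝ there is θ ∈ [0,2π) with (x,θ) ∈ R such that τ's response to I's first move ((x,0,0), ρ) is ((x, ρ(1−α)·cos θ, ρ(1−α)·sin θ), αρ); in particular, τ yields a uniformizing function f : ℝ → [0,2π) with (x, f(x)) ∈ R for all x. -/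
open Filter Topology

/-- The point `(a, b, c)` of `ℝ³` (with the Euclidean metric). -/
noncomputable def pt3 (a b c : ℝ) : EuclideanSpace ℝ (Fin 3) :=
  (WithLp.equiv 2 (Fin 3 → ℝ)).symm ![a, b, c]

/-- The target set coding the relation `R ⊆ ℝ × [0, 2π)` along the cylinder of
radius `r` around the `x`-axis: the points `(x, r cos θ, r sin θ)` for `(x, θ) ∈ R`,
together with all points at distance `> r` from the `x`-axis. -/
def cylinderTarget (r : ℝ) (R : Set (ℝ × ℝ)) : Set (EuclideanSpace ℝ (Fin 3)) :=
  {p | ∃ x θ : ℝ, θ ∈ Set.Ico (0 : ℝ) (2 * Real.pi) ∧ (x, θ) ∈ R ∧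
      p = pt3 x (r * Real.cos θ) (r * Real.sin θ)} ∪
    {p | r < Real.sqrt ((p 1) ^ 2 + (p 2) ^ 2)}

/-- Move the vector `w` by distance `a` towards the origin, stopping there if reached. -/
noncomputable def shrinkTowardZero {E : Type*} [NormedAddCommGroup E] [NormedSpace ℝ E]
    (a : ℝ) (w : E) : E :=
  (max 0 (‖w‖ - a) / ‖w‖) • w

section Shrink

variable {E : Type*} [NormedAddCommGroup E] [NormedSpace ℝ E]

theorem norm_shrinkTowardZero {a : ℝ} (ha : 0 ≤ a) (w : E) :
    ‖shrinkTowardZero a w‖ = max 0 (‖w‖ - a) := by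
  unfold shrinkTowardZero
  rcases eq_or_ne w 0 with rfl | hw
  · simp [ha]
  · have hw' : 0 < ‖w‖ := norm_pos_iff.mpr hw
    rw [norm_smul, Real.norm_of_nonneg (by positivity), div_mul_cancel₀ _ hw'.ne']

theorem norm_sub_shrinkTowardZero_le {a : ℝ} (ha : 0 ≤ a) (w : E) :
    ‖w - shrinkTowardZero a w‖ ≤ a := by
  unfold shrinkTowardZero
  rcases eq_or_ne w 0 with rfl | hw
  · simpa using ha
  · have hw' : 0 < ‖w‖ := norm_pos_iff.mpr hw
    have h : w - (max 0 (‖w‖ - a) / ‖w‖) • w = (1 - max 0 (‖w‖ - a) / ‖w‖) • w := by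
      rw [sub_smul, one_smul]
    have h2 : |1 - max 0 (‖w‖ - a) / ‖w‖| * ‖w‖ = |‖w‖ - max 0 (‖w‖ - a)| := by
      rw [← abs_of_pos hw', ← abs_mul, abs_of_pos hw', sub_mul, div_mul_cancel₀ _ hw'.ne',
        one_mul]
    rw [h, norm_smul, Real.norm_eq_abs, h2, abs_le]
    rcases max_cases 0 (‖w‖ - a) with ⟨h, h'⟩ | ⟨h, h'⟩ <;> rw [h] <;> constructor <;> linarith

end Shrink

section Extremal

variable {E : Type*} [NormedAddCommGroup E] [InnerProductSpace ℝ E]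

/-- Equality case of the triangle inequality for a displacement of length at most `b`. -/
theorem eq_smul_of_norm_sub_smul_le {v w : E} {s b : ℝ} (hv : ‖v‖ = 1) (hs : 0 < s)
    (hb : 0 ≤ b) (hle : ‖w - s • v‖ ≤ b) (hw : ‖w‖ = s + b) : w = (s + b) • v := by
  have h1 : ‖w - s • v‖ ^ 2 ≤ b ^ 2 := by gcongr
  have h2 : ‖w - (s + b) • v‖ ^ 2 ≤ 0 := by
    rw [norm_sub_sq_real, real_inner_smul_right, norm_smul, hv, hw, Real.norm_eq_abs, mul_one,
      sq_abs] at h1 ⊢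
    have h3 : s + b ≤ inner ℝ w v := by
      by_contra hcon
      push Not at hcon
      nlinarith
    nlinarith
  have h3 : ‖w - (s + b) • v‖ = 0 := by
    have := sq_nonneg ‖w - (s + b) • v‖
    exact pow_eq_zero_iff two_ne_zero |>.mp (le_antisymm h2 this)
  exact sub_eq_zero.mp (norm_eq_zero.mp h3)

/-- If one player moves by at most `b k` and the other one answers by moving `a k < b k`
towards the origin, then a limit at distance at least `∑ (b k - a k)` from the origin is reached
only by moving along a fixed ray. -/
theorem limit_eq_smul_of_shrinkTowardZero {a b : ℕ → ℝ} {y w : ℕ → E} {z : E} {r : ℝ}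
    (ha : ∀ k, 0 ≤ a k) (hab : ∀ k, a k < b k) (hsum : HasSum (fun k => b k - a k) r)
    (hy0 : y 0 = 0) (hw : ∀ k, ‖w k - y k‖ ≤ b k)
    (hy : ∀ k, y (k + 1) = shrinkTowardZero (a k) (w k))
    (hz : Tendsto y atTop (𝓝 z)) (hr : r ≤ ‖z‖) :
    ‖w 0‖ = b 0 ∧ z = (r / b 0) • w 0 := by
  set S : ℕ → ℝ := fun n => ∑ k ∈ Finset.range n, (b k - a k) with hS
  have hS_succ : ∀ k, S (k + 1) = S k + (b k - a k) := fun k => Finset.sum_range_succ _ k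
  have hS_lim : Tendsto S atTop (𝓝 r) := hsum.tendsto_sum_nat
  have hS_nonneg : ∀ k, 0 ≤ S k := fun k =>
    Finset.sum_nonneg fun i _ => (sub_pos.mpr (hab i)).le
  have hS_pos : ∀ k, 0 < S (k + 1) := fun k => by
    rw [hS_succ]; linarith [hS_nonneg k, hab k]
  have hw_le : ∀ k, ‖w k‖ ≤ ‖y k‖ + b k := fun k => by
    have h := norm_le_norm_add_norm_sub' (w k) (y k)
    linarith [hw k]
  have hdef : Monotone fun k => S k - ‖y k‖ := by
    refine monotone_nat_of_le_succ fun k => ?_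
    have h : max 0 (‖w k‖ - a k) ≤ ‖y k‖ + (b k - a k) :=
      max_le (by linarith [norm_nonneg (y k), hab k]) (by linarith [hw_le k])
    rw [hy, norm_shrinkTowardZero (ha k), hS_succ]
    linarith
  have hy_norm : ∀ k, ‖y k‖ = S k := fun k => by
    have h1 := hdef (Nat.zero_le k)
    have h2 := hdef.ge_of_tendsto (hS_lim.sub hz.norm) k
    simp only [hy0, hS, Finset.range_zero, Finset.sum_empty, norm_zero, sub_zero] at h1 h2 ⊢
    linarith
  have hw_norm : ∀ k, ‖w k‖ = S k + b k := fun k => by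
    have h := hy_norm (k + 1)
    have hpos := hS_pos k
    rw [hy, norm_shrinkTowardZero (ha k)] at h
    rcases max_cases 0 (‖w k‖ - a k) with ⟨h', -⟩ | ⟨h', -⟩
    · linarith
    · linarith [hS_succ k]
  have hS0 : S 0 = 0 := by simp [hS]
  have hb0 : 0 < b 0 := (ha 0).trans_lt (hab 0)
  have hw0 : ‖w 0‖ = b 0 := by rw [hw_norm, hS0, zero_add]
  refine ⟨hw0, ?_⟩
  set v : E := (b 0)⁻¹ • w 0 with hv
  have hv1 : ‖v‖ = 1 := by
    rw [hv, norm_smul, hw0, Real.norm_of_nonneg (by positivity), inv_mul_cancel₀ hb0.ne']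
  have hstep : ∀ k, w k = (S k + b k) • v → y (k + 1) = S (k + 1) • v := fun k hk => by
    have hpos : 0 < S k + b k := by linarith [hS_nonneg k, ha k, hab k]
    have h := hS_pos k
    rw [hy, shrinkTowardZero, hw_norm, show S k + b k - a k = S (k + 1) by rw [hS_succ]; ring,
      max_eq_right h.le, hk, smul_smul, div_mul_cancel₀ _ hpos.ne']
  have hw_ray : ∀ k, w k = (S k + b k) • v := fun k => by
    induction k with
    | zero => rw [hS0, zero_add, hv, smul_smul, mul_inv_cancel₀ hb0.ne', one_smul]
    | succ k ih =>
      refine eq_smul_of_norm_sub_smul_le hv1 (hS_pos k) ((ha _).trans (hab _).le) ?_ (hw_norm _)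
      rw [← hstep k ih]
      exact hw _
  have hlim : Tendsto (fun k => y (k + 1)) atTop (𝓝 (r • v)) := by
    have h : (fun k => y (k + 1)) = fun k => S (k + 1) • v :=
      funext fun k => hstep k (hw_ray k)
    rw [h]
    exact ((tendsto_add_atTop_iff_nat 1).mpr hS_lim).smul_const v
  rw [tendsto_nhds_unique ((tendsto_add_atTop_iff_nat 1).mpr hz) hlim, hv, smul_smul,
    div_eq_mul_inv]

end Extremal

theorem histOf_succ {M : Type*} (f : ℕ → M) (n : ℕ) : histOf f (n + 1) = histOf f n ++ [f n] := by
  simp [histOf, List.range_succ]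

theorem length_histOf {M : Type*} (f : ℕ → M) (n : ℕ) : (histOf f n).length = n := by
  simp [histOf]

/-- A run can be built by recursion on its history. -/
theorem exists_run_of_history {M : Type*} (Φ : List M → M) :
    ∃ f : ℕ → M, ∀ n, f n = Φ (histOf f n) := by
  let H : ℕ → List M := fun n => Nat.rec [] (fun _ l => l ++ [Φ l]) n
  refine ⟨fun n => Φ (H n), fun n => congrArg Φ ?_⟩
  induction n with
  | zero => rfl
  | succ n ih => rw [histOf_succ, ← ih]

/-- The run in which II follows `τ` while I opens with `m` and afterwards applies `g` to
the last move of II. -/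
theorem exists_followsII_run {M : Type*} (τ : List M → M) (m : M) (g : M → M) :
    ∃ f : ℕ → M, GameSpec.FollowsII τ f ∧ f 0 = m ∧ ∀ k, f (2 * k + 2) = g (f (2 * k + 1)) := by
  classical
  obtain ⟨f, hf⟩ := exists_run_of_history fun l : List M =>
    if l = [] then m else if Odd l.length then τ l else g (l.getLastD m)
  refine ⟨f, fun k => ?_, ?_, fun k => ?_⟩
  · rw [hf, if_neg (by simp [histOf_succ]),
      if_pos (by rw [length_histOf]; exact odd_two_mul_add_one k)]
  · rw [hf]; simp [histOf]
  · rw [hf, if_neg (by simp [histOf_succ]), if_neg (by rw [length_histOf]; grind)]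
    rw [histOf_succ]
    simp

theorem legal_of_forall_legalUpTo {M : Type*} {G : GameSpec M} {f : ℕ → M}
    (h : ∀ n, G.LegalUpTo f n) : G.Legal f :=
  ⟨(h 1).1 one_pos, fun i => (h (i + 1)).2.1 i i.lt_succ_self,
    fun i => (h (i + 2)).2.2 i (by omega)⟩

section Schmidt

variable {X : Type*} [MetricSpace X] {α β ρ : ℝ} {T : Set X}

theorem schmidtGameFixed_radius_pos (hα : 0 < α) (hβ : 0 < β) (hρ : 0 < ρ) {f : ℕ → X × ℝ}
    {n : ℕ} (h : (schmidtGameFixed α β ρ T).LegalUpTo f n) {i : ℕ} (hi : i < n) :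
    0 < (f i).2 := by
  induction i with
  | zero =>
    have h0 : (f 0).2 = ρ := h.1 hi
    rw [h0]; exact hρ
  | succ i ih =>
    have h2 := (h.2.2 i hi).2
    rw [h2]
    have := ih (by omega)
    split_ifs <;> positivity

theorem schmidtGameFixed_radius_even {f : ℕ → X × ℝ}
    (h : (schmidtGameFixed α β ρ T).Legal f) (k : ℕ) : (f (2 * k)).2 = ρ * (α * β) ^ k := by
  induction k with
  | zero =>
    have h0 : (f 0).2 = ρ := h.1
    simpa using h0
  | succ k ih =>
    have h1 : (f (2 * k + 1)).2 = (if Even (2 * k) then α else β) * (f (2 * k)).2 :=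
      (h.2.2 (2 * k)).2
    have h2 : (f (2 * k + 2)).2 = (if Even (2 * k + 1) then α else β) * (f (2 * k + 1)).2 :=
      (h.2.2 (2 * k + 1)).2
    rw [if_pos (even_two_mul k)] at h1
    rw [if_neg (by simp)] at h2
    rw [show 2 * (k + 1) = 2 * k + 2 by ring, h2, h1, ih]
    ring

theorem schmidtGameFixed_radius_odd {f : ℕ → X × ℝ}
    (h : (schmidtGameFixed α β ρ T).Legal f) (k : ℕ) :
    (f (2 * k + 1)).2 = α * (ρ * (α * β) ^ k) := by
  have h1 : (f (2 * k + 1)).2 = (if Even (2 * k) then α else β) * (f (2 * k)).2 :=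
    (h.2.2 (2 * k)).2
  rw [h1, if_pos (even_two_mul k), schmidtGameFixed_radius_even h]

/-- If II follows a winning strategy and I's moves are legal answers, then the run is legal. -/
theorem schmidtGameFixed_legal_of_winningII (hα : 0 < α) (hβ : 0 < β) (hρ : 0 < ρ)
    {τ : List (X × ℝ) → X × ℝ} (hτ : (schmidtGameFixed α β ρ T).WinningII τ)
    {f : ℕ → X × ℝ} (hf : GameSpec.FollowsII τ f) (h0 : (f 0).2 = ρ)
    (hstep : ∀ k, 0 < (f (2 * k + 1)).2 →
      (f (2 * k + 2)).2 + dist (f (2 * k + 1)).1 (f (2 * k + 2)).1 ≤ (f (2 * k + 1)).2 ∧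
        (f (2 * k + 2)).2 = β * (f (2 * k + 1)).2) :
    (schmidtGameFixed α β ρ T).Legal f := by
  have hodd : ∀ n, (schmidtGameFixed α β ρ T).LegalUpTo f (2 * n + 1) := fun n => by
    induction n with
    | zero => exact ⟨fun _ => h0, fun _ _ => trivial, fun i hi => by omega⟩
    | succ n ih =>
      have h := (hτ f hf).1 n ih
      refine ⟨fun _ => h0, fun _ _ => trivial, fun i hi => ?_⟩
      rcases Nat.lt_or_ge (i + 1) (2 * n + 2) with hlt | hge
      · exact h.2.2 i hlt
      · obtain rfl : i = 2 * n + 1 := by omega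
        obtain ⟨h1, h2⟩ := hstep n (schmidtGameFixed_radius_pos hα hβ hρ h (by omega))
        refine ⟨h1, ?_⟩
        rw [if_neg (by simp)]
        exact h2
  refine legal_of_forall_legalUpTo fun n => ?_
  have h := hodd n
  exact ⟨fun _ => h0, fun _ _ => trivial, fun i hi => h.2.2 i (by omega)⟩

end Schmidt

section InnerSchmidt

variable {E : Type*} [NormedAddCommGroup E] [InnerProductSpace ℝ E] {α β ρ r : ℝ} {T : Set E}

/-- If no target point is closer than `r` to the center `c` of I's first ball, then II's first
move under a winning strategy points towards a target point at distance `r` from `c`. -/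
theorem exists_target_of_winningII (hα : α ∈ Set.Ioo (0 : ℝ) 1) (hβ : β ∈ Set.Ioo (0 : ℝ) 1)
    (hαβ : α * (2 - β) < 1) (hρ : 0 < ρ)
    (hr : r = ρ * (1 - 2 * α * (1 - β) / (1 - α * β)))
    {τ : List (E × ℝ) → E × ℝ} (hτ : (schmidtGameFixed α β ρ T).WinningII τ) (c : E)
    (hT : ∀ z ∈ T, r ≤ ‖z - c‖) :
    0 < r ∧ ∃ z ∈ T, ‖z - c‖ = r ∧
      τ [(c, ρ)] = (c + (ρ * (1 - α) / r) • (z - c), α * ρ) := by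
  obtain ⟨hα0, hα1⟩ := hα
  obtain ⟨hβ0, hβ1⟩ := hβ
  have hq : α * β < 1 := by nlinarith
  have hq0 : 0 < α * β := by positivity
  have hr' : r = (ρ * (1 - α) - ρ * (α * (1 - β))) * (1 - α * β)⁻¹ := by
    have : 1 - α * β ≠ 0 := by linarith
    rw [hr]; field_simp; ring
  have hgap : ρ * (α * (1 - β)) < ρ * (1 - α) := mul_lt_mul_of_pos_left (by linarith) hρ
  have hr0 : 0 < r := by
    rw [hr']
    exact mul_pos (by linarith) (inv_pos.mpr (by linarith))
  obtain ⟨f, hf, hf0, hfI⟩ := exists_followsII_run τ (c, ρ) fun m =>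
    (c + shrinkTowardZero ((1 - β) * m.2) (m.1 - c), β * m.2)
  have hlegal : (schmidtGameFixed α β ρ T).Legal f := by
    refine schmidtGameFixed_legal_of_winningII hα0 hβ0 hρ hτ hf (by rw [hf0]) fun k hk => ?_
    rw [hfI]
    refine ⟨?_, rfl⟩
    have h := norm_sub_shrinkTowardZero_le (a := (1 - β) * (f (2 * k + 1)).2)
      (mul_nonneg (by linarith) hk.le) ((f (2 * k + 1)).1 - c)
    rw [sub_sub] at h
    dsimp only
    rw [dist_eq_norm]
    linarith
  obtain ⟨z, hzT, hz⟩ := (hτ f hf).2 hlegal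
  have hsum : HasSum (fun k => ρ * (1 - α) * (α * β) ^ k - ρ * (α * (1 - β)) * (α * β) ^ k) r := by
    rw [hr']
    simp only [← sub_mul]
    exact (hasSum_geometric_of_lt_one hq0.le hq).mul_left _
  have hlim : Tendsto (fun k => (f (2 * k)).1 - c) atTop (𝓝 (z - c)) :=
    (hz.comp (tendsto_id.const_mul_atTop' two_pos)).sub_const c
  obtain ⟨hw, hzw⟩ := limit_eq_smul_of_shrinkTowardZero
    (a := fun k => ρ * (α * (1 - β)) * (α * β) ^ k) (b := fun k => ρ * (1 - α) * (α * β) ^ k)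
    (y := fun k => (f (2 * k)).1 - c) (w := fun k => (f (2 * k + 1)).1 - c)
    (fun k => mul_nonneg (mul_nonneg hρ.le (mul_nonneg hα0.le (by linarith))) (by positivity))
    (fun k => mul_lt_mul_of_pos_right hgap (by positivity)) hsum (by simp [hf0])
    (fun k => by
      have h := (hlegal.2.2 (2 * k)).1
      rw [schmidtGameFixed_radius_even hlegal, schmidtGameFixed_radius_odd hlegal, dist_comm,
        dist_eq_norm] at h
      rw [sub_sub_sub_cancel_right]
      linarith)
    (fun k => by
      rw [show 2 * (k + 1) = 2 * k + 2 by ring, hfI, schmidtGameFixed_radius_odd hlegal,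
        add_sub_cancel_left]
      congr 1
      ring)
    hlim (hT z hzT)
  have hb : 0 < ρ * (1 - α) := mul_pos hρ (by linarith)
  simp only [mul_zero, zero_add, pow_zero, mul_one] at hw hzw
  have hτ1 : τ [(c, ρ)] = f 1 := by
    have h : f 1 = τ (histOf f 1) := hf 0
    rw [h]; simp [histOf, hf0]
  refine ⟨hr0, z, hzT, ?_, ?_⟩
  · rw [hzw, norm_smul, hw, Real.norm_of_nonneg (by positivity), div_mul_cancel₀ _ hb.ne']
  · rw [hτ1, hzw, smul_smul, div_mul_div_cancel₀ hr0.ne', div_self hb.ne', one_smul,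
      add_sub_cancel]
    have h : (f 1).2 = α * ρ := by simpa using schmidtGameFixed_radius_odd hlegal 0
    exact Prod.ext rfl h

end InnerSchmidt

theorem norm_sub_pt3_axis_sq (p : EuclideanSpace ℝ (Fin 3)) (x : ℝ) :
    ‖p - pt3 x 0 0‖ ^ 2 = (p 0 - x) ^ 2 + ((p 1) ^ 2 + (p 2) ^ 2) := by
  rw [EuclideanSpace.norm_sq_eq, Fin.sum_univ_three]
  simp [pt3, add_assoc]

theorem pt3_circle_sq (x r θ : ℝ) :
    (pt3 x (r * Real.cos θ) (r * Real.sin θ) 1) ^ 2 +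
      (pt3 x (r * Real.cos θ) (r * Real.sin θ) 2) ^ 2 = r ^ 2 := by
  simp only [pt3, WithLp.equiv_symm_apply, Matrix.cons_val]
  linear_combination r ^ 2 * Real.cos_sq_add_sin_sq θ

theorem le_radial_of_mem_cylinderTarget {r : ℝ} {R : Set (ℝ × ℝ)} {p : EuclideanSpace ℝ (Fin 3)}
    (hp : p ∈ cylinderTarget r R) : r ≤ Real.sqrt ((p 1) ^ 2 + (p 2) ^ 2) := by
  rcases hp with ⟨x, θ, -, -, rfl⟩ | hp
  · rw [pt3_circle_sq, Real.sqrt_sq_eq_abs]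
    exact le_abs_self r
  · exact hp.le

theorem radial_le_norm_sub_pt3_axis (p : EuclideanSpace ℝ (Fin 3)) (x : ℝ) :
    Real.sqrt ((p 1) ^ 2 + (p 2) ^ 2) ≤ ‖p - pt3 x 0 0‖ := by
  refine Real.sqrt_le_iff.mpr ⟨norm_nonneg _, ?_⟩
  rw [norm_sub_pt3_axis_sq]
  linarith [sq_nonneg (p 0 - x)]

/-- Let `α, β ∈ (0,1)` with `α(2-β) < 1`, `ρ > 0`, `r = ρ(1 - 2α(1-β)/(1-αβ))`,
and let `R ⊆ ℝ × [0, 2π)` be total.  If `τ` is a winning strategy for player II in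
Schmidt's `(α, β, ρ)` game on `ℝ³` with the cylinder target set, then for every
`x ∈ ℝ` there is `θ ∈ [0, 2π)` with `(x, θ) ∈ R` such that `τ`'s response to the
first move `((x,0,0), ρ)` of player I is `((x, ρ(1-α)cos θ, ρ(1-α)sin θ), αρ)`;
in particular `τ` yields a uniformizing function for `R`. -/
theorem playerII_strategy_uniformizes_cylinder
    (α β ρ r : ℝ) (hα : α ∈ Set.Ioo (0 : ℝ) 1) (hβ : β ∈ Set.Ioo (0 : ℝ) 1)
    (hαβ : α * (2 - β) < 1) (hρ : 0 < ρ)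
    (hr : r = ρ * (1 - 2 * α * (1 - β) / (1 - α * β)))
    (R : Set (ℝ × ℝ)) (hR : ∀ x : ℝ, ∃ θ ∈ Set.Ico (0 : ℝ) (2 * Real.pi), (x, θ) ∈ R)
    (τ : List (EuclideanSpace ℝ (Fin 3) × ℝ) → EuclideanSpace ℝ (Fin 3) × ℝ)
    (hτ : (schmidtGameFixed α β ρ (cylinderTarget r R)).WinningII τ) :
    (∀ x : ℝ, ∃ θ ∈ Set.Ico (0 : ℝ) (2 * Real.pi), (x, θ) ∈ R ∧
        τ [(pt3 x 0 0, ρ)] =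
          (pt3 x (ρ * (1 - α) * Real.cos θ) (ρ * (1 - α) * Real.sin θ), α * ρ)) ∧
      ∃ f : ℝ → ℝ, ∀ x : ℝ, f x ∈ Set.Ico (0 : ℝ) (2 * Real.pi) ∧ (x, f x) ∈ R := by
  refine ⟨fun x => ?_, Classical.axiomOfChoice hR |>.imp fun f hf => hf⟩
  obtain ⟨hr0, z, hzT, hz, hmove⟩ := exists_target_of_winningII hα hβ hαβ hρ hr hτ (pt3 x 0 0)
    fun z hz => (le_radial_of_mem_cylinderTarget hz).trans (radial_le_norm_sub_pt3_axis z x)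
  rcases hzT with ⟨x', θ, hθ, hxθ, rfl⟩ | hfar
  · have hsq := norm_sub_pt3_axis_sq (pt3 x' (r * Real.cos θ) (r * Real.sin θ)) x
    rw [hz, pt3_circle_sq] at hsq
    have h0 : (x' - x) ^ 2 = 0 := by
      simp only [pt3, WithLp.equiv_symm_apply, Matrix.cons_val] at hsq
      linarith
    obtain rfl : x' = x := sub_eq_zero.mp (pow_eq_zero_iff two_ne_zero |>.mp h0)
    refine ⟨θ, hθ, hxθ, hmove.trans (Prod.ext ?_ rfl)⟩
    ext i
    fin_cases i <;> simp [pt3] <;> field_simp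
  · have hlt : r < Real.sqrt ((z 1) ^ 2 + (z 2) ^ 2) := hfar
    exact absurd (hlt.trans_le (radial_le_norm_sub_pt3_axis z x)) (by rw [hz]; exact lt_irrefl r)
end
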